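/- Let K be a field with a surjective additive valuation v : K → ℝ∞, and let I be an ideal of K[x_1,…,x_n] generated by homogeneous linear forms (so that B = K[x_1,…,x_n]/I is the coordinate ring of a linear subspace Y of affine n-space). Then the surjective map trop : Y^an → Trop(Y) has a continuous section: there exists a continuous map σ : Trop(Y) → Y^an such that trop(σ(η)) = η for every η ∈ Trop(Y). -/

import Mathlib

open scoped Classical

noncomputable section

/-- `ℝ∞ = ℝ ∪ {∞}`, with the order topology. -/
abbrev RInf := WithTop ℝ

noncomputable instance : TopologicalSpace RInf := Preorder.topology RInf
instance : OrderTopology RInf := ⟨rfl⟩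

/-- An additive (non-Archimedean) valuation on a commutative ring, with values in
`ℝ∞`: `w(ab) = w(a) + w(b)`, `w(a+b) ≥ min (w a) (w b)`, `w 1 = 0`, `w 0 = ∞`. -/
structure IsVal {R : Type*} [CommRing R] (w : R → RInf) : Prop where
  map_mul : ∀ a b, w (a * b) = w a + w b
  min_le_add : ∀ a b, min (w a) (w b) ≤ w (a + b)
  map_one : w 1 = 0
  map_zero : w 0 = ⊤

/-- The analytification of `Spec B`: the set of additive valuations on the `K`-algebra
`B` extending the valuation `v` on `K`, as a subset of the product space `B → ℝ∞`
(topology of pointwise convergence). -/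
def An {K : Type*} [Field K] (v : K → RInf) (B : Type*) [CommRing B] [Algebra K B] :
    Set (B → RInf) :=
  {w | IsVal w ∧ ∀ c : K, w (algebraMap K B c) = v c}

variable {K : Type*} [Field K] {ι M : Type*} [Fintype M]

/-- Weight of a monomial exponent `α` with respect to weight vectors `a`. -/
def wt (a : ι → M → ℤ) (α : ι →₀ ℕ) : M → ℤ :=
  α.sum fun i k => (k : ℤ) • a i

/-- The weight-`β` component `F_β` of a polynomial `F`: the sum of the terms `c·x^α`
of `F` with `Σ_i α_i a_i = β`. -/
def wtComp (a : ι → M → ℤ) (F : MvPolynomial ι K) (β : M → ℤ) : MvPolynomial ι K :=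
  ∑ α ∈ F.support.filter (fun α => wt a α = β), MvPolynomial.monomial α (F.coeff α)

/-- An ideal is weight-homogeneous if it contains all weight components of its
members. -/
def WtHomog (a : ι → M → ℤ) (I : Ideal (MvPolynomial ι K)) : Prop :=
  ∀ F ∈ I, ∀ β : M → ℤ, wtComp a F β ∈ I

/-- Pairing `β·τ` of an integer vector with a real vector. -/
def pairR (β : M → ℤ) (τ : M → ℝ) : ℝ := ∑ j, (β j : ℝ) * τ j

/-- `ν(F) = min_β (w(F̄_β) + β·τ)`: the minimum over the finitely many `β` with
`F_β ≠ 0`, with value `∞` for `F = 0`. -/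
def muAux (a : ι → M → ℤ) (I : Ideal (MvPolynomial ι K))
    (w : (MvPolynomial ι K ⧸ I) → RInf) (τ : M → ℝ) (F : MvPolynomial ι K) : RInf :=
  (F.support.image (wt a)).inf fun β =>
    w (Ideal.Quotient.mk I (wtComp a F β)) + ((pairR β τ : ℝ) : RInf)

/-- `μ(τ,w) : B → ℝ∞`, computed on an arbitrary lift of `f` (for weight-homogeneous
`I` this is independent of the lift). -/
def mu (a : ι → M → ℤ) (I : Ideal (MvPolynomial ι K)) (τ : M → ℝ)
    (w : (MvPolynomial ι K ⧸ I) → RInf) : (MvPolynomial ι K ⧸ I) → RInf :=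
  fun f => muAux a I w τ (Function.surjInv Ideal.Quotient.mk_surjective f)

/-- The tropicalisation map `X^an → ℝ∞^ι`, `w ↦ (w(x̄_i))_i`. -/
def tropMap (I : Ideal (MvPolynomial ι K)) (w : (MvPolynomial ι K ⧸ I) → RInf) :
    ι → RInf :=
  fun i => w (Ideal.Quotient.mk I (MvPolynomial.X i))

/-- `Trop(X)`: the image of the analytification under `trop`, inside `ℝ∞^ι`. -/
def TropSet (v : K → RInf) (I : Ideal (MvPolynomial ι K)) : Set (ι → RInf) :=
  {η | ∃ w ∈ An v (MvPolynomial ι K ⧸ I), tropMap I w = η}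

/-- `Trop(X⁰)`: the points of `Trop(X)` with all coordinates finite, inside `ℝ^ι`. -/
def TropSet0 (v : K → RInf) (I : Ideal (MvPolynomial ι K)) : Set (ι → ℝ) :=
  {ξ | ∃ w ∈ An v (MvPolynomial ι K ⧸ I), ∀ i, tropMap I w i = ((ξ i : ℝ) : RInf)}

end

namespace IsVal

variable {R : Type*} [CommRing R] {w : R → RInf}

lemma map_neg_one (hw : IsVal w) : w (-1) = 0 := by
  have h : w (-1) + w (-1) = 0 := by
    rw [← hw.map_mul, neg_one_mul, neg_neg, hw.map_one]
  generalize w (-1) = x at h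
  induction x using WithTop.recTopCoe with
  | top => simp at h
  | coe x =>
    norm_cast at h ⊢
    linarith

lemma map_neg (hw : IsVal w) (a : R) : w (-a) = w a := by
  rw [← neg_one_mul, hw.map_mul, hw.map_neg_one, zero_add]

lemma map_pow (hw : IsVal w) (a : R) (k : ℕ) : w (a ^ k) = k • w a := by
  induction k with
  | zero => simp [hw.map_one]
  | succ k ih => rw [pow_succ, hw.map_mul, ih, succ_nsmul]

lemma map_prod (hw : IsVal w) {κ : Type*} (s : Finset κ) (f : κ → R) :
    w (∏ i ∈ s, f i) = ∑ i ∈ s, w (f i) := by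
  induction s using Finset.induction_on with
  | empty => simp [hw.map_one]
  | insert i s hi ih => rw [Finset.prod_insert hi, Finset.sum_insert hi, hw.map_mul, ih]

lemma min_add_le (hw : IsVal w) (a b : R) (t : RInf) :
    min (w a + t) (w b + t) ≤ w (a + b) + t := by
  rw [← (show Monotone fun x : RInf => x + t from fun _ _ h => add_le_add_left h t).map_min]
  exact add_le_add_left (hw.min_le_add a b) t

lemma le_map_sum_add (hw : IsVal w) {κ : Type*} {s : Finset κ} {f : κ → R} {r t : RInf}
    (h : ∀ i ∈ s, r ≤ w (f i) + t) : r ≤ w (∑ i ∈ s, f i) + t := by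
  induction s using Finset.induction_on with
  | empty => simp [hw.map_zero]
  | insert i s hi ih =>
    rw [Finset.sum_insert hi]
    refine le_trans (le_min (h i (Finset.mem_insert_self i s)) (ih fun j hj => ?_))
      (hw.min_add_le _ _ t)
    exact h j (Finset.mem_insert_of_mem hj)

lemma le_map_sum (hw : IsVal w) {κ : Type*} {s : Finset κ} {f : κ → R} {r : RInf}
    (h : ∀ i ∈ s, r ≤ w (f i)) : r ≤ w (∑ i ∈ s, f i) := by
  simpa using hw.le_map_sum_add (t := 0) (by simpa using h)

lemma lt_map_sum_add (hw : IsVal w) {κ : Type*} {s : Finset κ} {f : κ → R} {r t : RInf}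
    (hr : r < ⊤) (h : ∀ i ∈ s, r < w (f i) + t) : r < w (∑ i ∈ s, f i) + t := by
  induction s using Finset.induction_on with
  | empty => simpa [hw.map_zero] using hr
  | insert i s hi ih =>
    rw [Finset.sum_insert hi]
    refine lt_of_lt_of_le (lt_min (h i (Finset.mem_insert_self i s)) (ih fun j hj => ?_))
      (hw.min_add_le _ _ t)
    exact h j (Finset.mem_insert_of_mem hj)

/-- The value of a sum with a strictly dominant term is the value of that term. -/
lemma map_add_add_of_lt (hw : IsVal w) {a b : R} {t : RInf} (h : w a + t < w b + t) :
    w (a + b) + t = w a + t := by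
  refine le_antisymm ?_ (by simpa [h.le] using hw.min_add_le a b t)
  by_contra! hlt
  have := hw.min_add_le (a + b) (-b) t
  rw [add_neg_cancel_right, hw.map_neg] at this
  exact absurd (lt_of_lt_of_le (lt_min hlt h) this) (lt_irrefl _)

lemma comp (hw : IsVal w) {A : Type*} [CommRing A] (φ : A →+* R) :
    IsVal fun a => w (φ a) where
  map_mul a b := by rw [_root_.map_mul, hw.map_mul]
  min_le_add a b := by rw [map_add]; exact hw.min_le_add _ _
  map_one := by rw [_root_.map_one, hw.map_one]
  map_zero := by rw [_root_.map_zero, hw.map_zero]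

lemma map_inv_add {K : Type*} [Field K] {v : K → RInf} (hv : IsVal v) {a : K} (ha : a ≠ 0) :
    v a⁻¹ + v a = 0 := by
  rw [← hv.map_mul, inv_mul_cancel₀ ha, hv.map_one]

end IsVal

section Topology

lemma isEmbedding_rInf_eReal : Topology.IsEmbedding (WithBot.some : RInf → EReal) := by
  refine StrictMono.isEmbedding_of_ordConnected (fun a b h => WithBot.coe_lt_coe.2 h) ?_
  rw [WithBot.range_coe]
  exact Set.ordConnected_Ioi

instance : ContinuousAdd RInf := by
  refine ⟨isEmbedding_rInf_eReal.continuous_iff.2 (continuous_iff_continuousAt.2 ?_)⟩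
  rintro ⟨a, b⟩
  have hadd : ContinuousAt (fun p : EReal × EReal => p.1 + p.2)
      (WithBot.some a, WithBot.some b) :=
    EReal.continuousAt_add (Or.inr (WithBot.coe_ne_bot)) (Or.inl (WithBot.coe_ne_bot))
  have hcoe : ContinuousAt
      (Prod.map (WithBot.some : RInf → EReal) (WithBot.some : RInf → EReal)) (a, b) :=
    (isEmbedding_rInf_eReal.continuous.prodMap isEmbedding_rInf_eReal.continuous).continuousAt
  exact ContinuousAt.comp (f := Prod.map (WithBot.some : RInf → EReal) WithBot.some) hadd hcoe

end Topology

section Gauss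

variable {K : Type*} [Field K] {ι : Type*} [Fintype ι] {v : K → RInf}

/-- The value of the term of exponent `α` of `F` when `x_i` is given the value `η i`. -/
noncomputable def termVal (v : K → RInf) (η : ι → RInf) (F : MvPolynomial ι K) (α : ι →₀ ℕ) : RInf :=
  v (F.coeff α) + ∑ i, α i • η i

/-- The Gauss valuation on a polynomial ring with weights `η`. -/
noncomputable def gaussVal (v : K → RInf) (η : ι → RInf) (F : MvPolynomial ι K) : RInf :=
  F.support.inf (termVal v η F)

lemma termVal_of_coeff_eq_zero (hv : IsVal v) (η : ι → RInf) {F : MvPolynomial ι K}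
    {α : ι →₀ ℕ} (h : F.coeff α = 0) : termVal v η F α = ⊤ := by
  simp [termVal, h, hv.map_zero]

lemma gaussVal_le_termVal (hv : IsVal v) (η : ι → RInf) (F : MvPolynomial ι K) (α : ι →₀ ℕ) :
    gaussVal v η F ≤ termVal v η F α := by
  by_cases h : F.coeff α = 0
  · simp [termVal_of_coeff_eq_zero hv η h]
  · exact Finset.inf_le (MvPolynomial.mem_support_iff.2 h)

lemma le_gaussVal {η : ι → RInf} {F : MvPolynomial ι K} {r : RInf}
    (h : ∀ α, r ≤ termVal v η F α) : r ≤ gaussVal v η F :=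
  Finset.le_inf fun α _ => h α

lemma continuous_gaussVal (v : K → RInf) (F : MvPolynomial ι K) :
    Continuous fun η : ι → RInf => gaussVal v η F := by
  refine Continuous.finset_inf_apply fun α _ => continuous_const.add ?_
  exact continuous_finsetSum _ fun i _ => (continuous_apply i).nsmul _

lemma termVal_add_termVal (hv : IsVal v) (η : ι → RInf) (F H : MvPolynomial ι K)
    (α β : ι →₀ ℕ) :
    v (F.coeff α * H.coeff β) + ∑ i, (α + β) i • η i = termVal v η F α + termVal v η H β := by
  simp only [termVal, hv.map_mul, Finsupp.add_apply, add_nsmul, Finset.sum_add_distrib]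
  exact add_add_add_comm _ _ _ _

lemma gaussVal_add_le_mul (hv : IsVal v) (η : ι → RInf) (F H : MvPolynomial ι K) :
    gaussVal v η F + gaussVal v η H ≤ gaussVal v η (F * H) := by
  refine le_gaussVal fun γ => ?_
  rw [termVal, MvPolynomial.coeff_mul]
  refine hv.le_map_sum_add fun p hp => ?_
  rw [← Finset.HasAntidiagonal.mem_antidiagonal.1 hp, termVal_add_termVal hv]
  exact add_le_add (gaussVal_le_termVal hv η F _) (gaussVal_le_termVal hv η H _)

/-- The last exponent, for an additive linear order on exponents, at which the Gauss
valuation is attained. -/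
lemma exists_last_termVal_eq {Γ : Type*} [LinearOrder Γ] (d : (ι →₀ ℕ) → Γ)
    (hv : IsVal v) (η : ι → RInf) {F : MvPolynomial ι K} (hF : gaussVal v η F < ⊤) :
    ∃ α, termVal v η F α = gaussVal v η F ∧
      ∀ β, d α < d β → gaussVal v η F < termVal v η F β := by
  have hne : F.support.Nonempty := by
    by_contra h
    rw [Finset.not_nonempty_iff_eq_empty] at h
    simp [gaussVal, h] at hF
  obtain ⟨α₀, h₀, h₀'⟩ := Finset.exists_mem_eq_inf F.support hne (termVal v η F)
  obtain ⟨α, hα, hmax⟩ := Finset.exists_max_image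
    (F.support.filter fun α => termVal v η F α = gaussVal v η F) d
    ⟨α₀, Finset.mem_filter.2 ⟨h₀, h₀'.symm⟩⟩
  refine ⟨α, (Finset.mem_filter.1 hα).2, fun β hβ => ?_⟩
  refine lt_of_le_of_ne (gaussVal_le_termVal hv η F β) fun heq => ?_
  have hβ' : β ∈ F.support := by
    rw [MvPolynomial.mem_support_iff]
    intro h
    rw [heq, termVal_of_coeff_eq_zero hv η h] at hF
    exact lt_irrefl _ hF
  exact absurd (hmax β (Finset.mem_filter.2 ⟨hβ', heq.symm⟩)) (not_le.2 hβ)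

lemma gaussVal_mul [LinearOrder ι] (hv : IsVal v) (η : ι → RInf) (F H : MvPolynomial ι K) :
    gaussVal v η (F * H) = gaussVal v η F + gaussVal v η H := by
  refine le_antisymm ?_ (gaussVal_add_le_mul hv η F H)
  rcases eq_or_ne (gaussVal v η F) ⊤ with hF | hF
  · simp [hF]
  rcases eq_or_ne (gaussVal v η H) ⊤ with hH | hH
  · simp [hH]
  let d := (MonomialOrder.lex (σ := ι)).toSyn
  obtain ⟨α, hα, hα'⟩ := exists_last_termVal_eq d hv η (lt_top_iff_ne_top.2 hF)
  obtain ⟨β, hβ, hβ'⟩ := exists_last_termVal_eq d hv η (lt_top_iff_ne_top.2 hH)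
  refine (gaussVal_le_termVal hv η _ (α + β)).trans_eq ?_
  have hlead := termVal_add_termVal hv η F H α β
  rw [hα, hβ] at hlead
  have hmem : (α, β) ∈ Finset.HasAntidiagonal.antidiagonal (α + β) := Finset.HasAntidiagonal.mem_antidiagonal.2 rfl
  rw [termVal, MvPolynomial.coeff_mul, ← Finset.add_sum_erase _ _ hmem, ← hlead]
  refine hv.map_add_add_of_lt ?_
  rw [hlead]
  refine hv.lt_map_sum_add (WithTop.add_lt_top.2 ⟨hF.lt_top, hH.lt_top⟩) ?_
  rintro ⟨a, b⟩ hab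
  obtain ⟨hne, hab⟩ := Finset.mem_erase.1 hab
  have hab : a + b = α + β := Finset.HasAntidiagonal.mem_antidiagonal.1 hab
  rw [← hab, termVal_add_termVal hv]
  have hd : d a + d b = d α + d β := by rw [← map_add, ← map_add, hab]
  have hle := gaussVal_le_termVal hv η F a
  have hle' := gaussVal_le_termVal hv η H b
  rcases lt_trichotomy (d α) (d a) with h | h | h
  · exact WithTop.add_lt_add_of_lt_of_le hH (hα' a h) hle'
  · rw [h] at hd
    have h₁ : α = a := d.injective h
    have h₂ : b = β := d.injective (add_left_cancel hd)
    exact absurd (by rw [h₁, h₂]) hne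
  · have hb : d β < d b := by
      by_contra! hb
      exact absurd hd (add_lt_add_of_lt_of_le h hb).ne
    exact WithTop.add_lt_add_of_le_of_lt hF hle (hβ' b hb)

lemma gaussVal_C (hv : IsVal v) (η : ι → RInf) (c : K) :
    gaussVal v η (MvPolynomial.C c) = v c := by
  refine le_antisymm ((gaussVal_le_termVal hv η _ 0).trans_eq (by simp [termVal])) ?_
  refine le_gaussVal fun α => ?_
  rcases eq_or_ne α 0 with rfl | h
  · simp [termVal]
  · rw [termVal_of_coeff_eq_zero hv η (by rw [MvPolynomial.coeff_C, if_neg h.symm])]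
    exact le_top

lemma le_gaussVal_X (hv : IsVal v) (η : ι → RInf) (i : ι) :
    η i ≤ gaussVal v η (MvPolynomial.X i) := by
  refine le_gaussVal fun α => ?_
  rcases eq_or_ne (Finsupp.single i 1) α with rfl | h
  · simp [termVal, hv.map_one, Finsupp.single_apply, ite_smul]
  · rw [termVal_of_coeff_eq_zero hv η (by rw [MvPolynomial.coeff_X, if_neg h])]
    exact le_top

lemma isVal_gaussVal [LinearOrder ι] (hv : IsVal v) (η : ι → RInf) :
    IsVal (gaussVal v η) where
  map_mul := gaussVal_mul hv η
  min_le_add F H := le_gaussVal fun α => by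
    rw [termVal, MvPolynomial.coeff_add]
    exact (min_le_min (gaussVal_le_termVal hv η F α) (gaussVal_le_termVal hv η H α)).trans
      (hv.min_add_le _ _ _)
  map_one := by rw [← MvPolynomial.C_1, gaussVal_C hv, hv.map_one]
  map_zero := by simp [gaussVal]

/-- The Gauss valuation is the smallest valuation extending `v` with given values at the
variables. -/
lemma gaussVal_le {w : MvPolynomial ι K → RInf} (hw : IsVal w)
    (hC : ∀ c, w (MvPolynomial.C c) = v c) (F : MvPolynomial ι K) :
    gaussVal v (fun i => w (MvPolynomial.X i)) F ≤ w F := by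
  conv_rhs => rw [F.as_sum]
  refine hw.le_map_sum fun α hα => ?_
  refine (Finset.inf_le hα).trans_eq ?_
  rw [MvPolynomial.monomial_eq, hw.map_mul, hC, Finsupp.prod_fintype _ _ (by simp), hw.map_prod]
  simp only [hw.map_pow, termVal]

end Gauss

section Basis

variable {K : Type*} [Field K] {v : K → RInf} {ι E : Type*} [Fintype ι] [AddCommGroup E]
  [Module K E]

/-- `u` is a linear combination of the `x_j`, `j ∈ S`, all of whose terms have weight at
least `r`. -/
def Dominates (v : K → RInf) (η : ι → RInf) (x : ι → E) (S : Finset ι) (u : E) (r : RInf) :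
    Prop :=
  ∃ c : ι → K, (∀ j ∉ S, c j = 0) ∧ ∑ j, c j • x j = u ∧ ∀ j, r ≤ v (c j) + η j

lemma Dominates.self (hv : IsVal v) (η : ι → RInf) (x : ι → E) {S : Finset ι} {i : ι}
    (hi : i ∈ S) : Dominates v η x S (x i) (η i) := by
  refine ⟨Pi.single i 1, fun j hj => Pi.single_eq_of_ne (by rintro rfl; exact hj hi) _, ?_,
    fun j => ?_⟩
  · simp [Pi.single_apply, ite_smul]
  · rcases eq_or_ne j i with rfl | h
    · simp [hv.map_one]
    · simp [Pi.single_eq_of_ne h, hv.map_zero]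

lemma Dominates.trans (hv : IsVal v) {η : ι → RInf} {x : ι → E} {S T : Finset ι} {u : E}
    {r : RInf} (hu : Dominates v η x T u r) (hT : ∀ i ∈ T, Dominates v η x S (x i) (η i)) :
    Dominates v η x S u r := by
  obtain ⟨c, hc, hcu, hcr⟩ := hu
  choose! a ha hax har using hT
  refine ⟨fun j => ∑ i ∈ T, c i * a i j, fun j hj => ?_, ?_, fun j => ?_⟩
  · exact Finset.sum_eq_zero fun i hi => by rw [ha i hi j hj, mul_zero]
  · simp_rw [Finset.sum_smul, mul_smul]
    rw [Finset.sum_comm]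
    simp_rw [← Finset.smul_sum]
    rw [Finset.sum_congr rfl fun i hi => by rw [hax i hi], ← hcu]
    exact Finset.sum_subset (Finset.subset_univ T) fun i _ hi => by rw [hc i hi, zero_smul]
  · refine hv.le_map_sum_add fun i hi => ?_
    rw [hv.map_mul, add_assoc]
    exact (hcr i).trans (add_le_add_right (har i hi j) _)

lemma Dominates.of_relation (hv : IsVal v) {η : ι → RInf} {x : ι → E} {S : Finset ι}
    {c : ι → K} (hcS : ∀ j ∉ S, c j = 0) (hc : ∑ j, c j • x j = 0) (hne : c ≠ 0) :
    ∃ i ∈ S, Dominates v η x (S.erase i) (x i) (η i) := by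
  obtain ⟨k, hk⟩ := Function.ne_iff.1 hne
  obtain ⟨i, hi, hmin⟩ := Finset.exists_min_image (Finset.univ.filter fun j => c j ≠ 0)
    (fun j => v (c j) + η j) ⟨k, by simpa using hk⟩
  have hci : c i ≠ 0 := (Finset.mem_filter.1 hi).2
  refine ⟨i, by_contra fun h => hci (hcS i h),
    fun j => if j = i then 0 else -((c i)⁻¹ * c j), fun j hj => ?_, ?_, fun j => ?_⟩
  · simp only [ite_eq_left_iff]
    intro h
    rw [hcS j fun hjS => hj (Finset.mem_erase.2 ⟨h, hjS⟩), mul_zero, neg_zero]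
  · rw [← Finset.add_sum_erase _ _ (Finset.mem_univ i)] at hc ⊢
    beta_reduce
    rw [if_pos rfl, zero_smul, zero_add, Finset.sum_congr rfl fun j hj => by
      rw [if_neg (Finset.ne_of_mem_erase hj), neg_smul, mul_smul]]
    rw [Finset.sum_neg_distrib, ← Finset.smul_sum, ← smul_neg, ← eq_neg_of_add_eq_zero_left hc,
      smul_smul, inv_mul_cancel₀ hci, one_smul]
  · by_cases h : j = i ∨ c j = 0
    · have : (if j = i then 0 else -((c i)⁻¹ * c j)) = 0 := by
        rcases h with h | h <;> simp [h]
      simp [this, hv.map_zero]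
    · push Not at h
      beta_reduce
      rw [if_neg h.1, hv.map_neg, hv.map_mul, add_assoc]
      calc η i = v (c i)⁻¹ + (v (c i) + η i) := by
            rw [← add_assoc, hv.map_inv_add hci, zero_add]
        _ ≤ _ := add_le_add_right (hmin j (by simpa using h.2)) _

/-- For every weight there is a linearly independent subfamily adapted to it. -/
lemma exists_adapted_independent (hv : IsVal v) (η : ι → RInf) (x : ι → E) :
    ∃ S : Finset ι, (∀ i, Dominates v η x S (x i) (η i)) ∧
      ∀ c : ι → K, (∀ j ∉ S, c j = 0) → ∑ j, c j • x j = 0 → c = 0 := by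
  obtain ⟨S, hS, hmin⟩ := Finset.exists_min_image
    (Finset.univ.filter fun S : Finset ι => ∀ i, Dominates v η x S (x i) (η i)) Finset.card
    ⟨Finset.univ, by simpa using fun i => Dominates.self hv η x (Finset.mem_univ i)⟩
  have hS : ∀ i, Dominates v η x S (x i) (η i) := (Finset.mem_filter.1 hS).2
  refine ⟨S, hS, fun c hcS hc => ?_⟩
  by_contra hne
  obtain ⟨i, hi, hdom⟩ := Dominates.of_relation hv (η := η) hcS hc hne
  refine absurd (hmin (S.erase i) ?_) (not_le.2 (Finset.card_erase_lt_of_mem hi))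
  refine Finset.mem_filter.2 ⟨Finset.mem_univ _, fun k => (hS k).trans hv fun j hj => ?_⟩
  rcases eq_or_ne j i with rfl | h
  · exact hdom
  · exact Dominates.self hv η x (Finset.mem_erase.2 ⟨h, hj⟩)

end Basis

section LinearSpace

open MvPolynomial

variable {K : Type*} [Field K] {v : K → RInf} {ι : Type*} [Fintype ι]
  {I : Ideal (MvPolynomial ι K)}

/-- `ψ` is a section of the projection onto the coordinate ring fixing the coordinates in
`S`. -/
def IsCoordSection (I : Ideal (MvPolynomial ι K)) (S : Finset ι)
    (ψ : (MvPolynomial ι K ⧸ I) →ₐ[K] MvPolynomial ι K) : Prop :=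
  (∀ f, Ideal.Quotient.mk I (ψ f) = f) ∧ ∀ j ∈ S, ψ (Ideal.Quotient.mk I (X j)) = X j

lemma sum_coeff_smul_X {F : MvPolynomial ι K} (hF : F.IsHomogeneous 1) :
    ∑ i, F.coeff (Finsupp.single i 1) • X i = F := by
  ext α
  simp only [coeff_sum, coeff_smul, coeff_X, smul_eq_mul, mul_ite, mul_one, mul_zero]
  by_cases h : F.coeff α = 0
  · rw [h]
    refine Finset.sum_eq_zero fun i _ => ?_
    split_ifs with hi
    · rw [hi, h]
    · rfl
  · have hα : α.degree = 1 := by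
      rw [← hF h, Finsupp.degree_eq_weight_one]
      rfl
    obtain ⟨i, rfl⟩ : α ∈ Set.range fun i => Finsupp.single i 1 := by
      rw [Finsupp.range_single_one]
      exact hα
    rw [Finset.sum_eq_single i]
    · simp
    · intro j _ hj
      rw [if_neg fun h => hj ((Finsupp.single_left_injective one_ne_zero) h)]
    · simp

lemma exists_isCoordSection {G : Set (MvPolynomial ι K)} (hG : ∀ F ∈ G, F.IsHomogeneous 1)
    {S : Finset ι} (hI : I = Ideal.span G)
    (hspan : ∀ i, ∃ c : ι → K, (∀ j ∉ S, c j = 0) ∧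
      ∑ j, c j • Ideal.Quotient.mk I (X j) = Ideal.Quotient.mk I (X i))
    (hind : ∀ c : ι → K, (∀ j ∉ S, c j = 0) →
      ∑ j, c j • Ideal.Quotient.mk I (X j) = 0 → c = 0) :
    ∃ ψ, IsCoordSection I S ψ := by
  choose a ha hax using hspan
  let φ : MvPolynomial ι K →ₐ[K] MvPolynomial ι K := aeval fun i => ∑ j, a i j • X j
  have hφX (i) : φ (X i) = ∑ j, a i j • X j := aeval_X _ i
  have hmk : ((Ideal.Quotient.mkₐ K I).comp φ) = Ideal.Quotient.mkₐ K I := by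
    refine algHom_ext fun i => ?_
    rw [AlgHom.comp_apply, hφX, map_sum]
    simp only [map_smul, Ideal.Quotient.mkₐ_eq_mk, hax]
  have hφG : ∀ F ∈ G, φ F = 0 := by
    intro F hF
    have hFI : Ideal.Quotient.mk I F = 0 :=
      Ideal.Quotient.eq_zero_iff_mem.2 (hI ▸ Ideal.subset_span hF)
    have hφF : φ F = ∑ j, (∑ i, F.coeff (Finsupp.single i 1) * a i j) • X j := by
      conv_lhs => rw [← sum_coeff_smul_X (hG F hF)]
      simp_rw [map_sum, map_smul, hφX, Finset.smul_sum, smul_smul, Finset.sum_smul]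
      exact Finset.sum_comm
    have hzero := hind (fun j => ∑ i, F.coeff (Finsupp.single i 1) * a i j)
      (fun j hj => Finset.sum_eq_zero fun i _ => by rw [ha i j hj, mul_zero]) (by
        have h := DFunLike.congr_fun hmk F
        rw [AlgHom.comp_apply, hφF, map_sum] at h
        simpa only [map_smul, Ideal.Quotient.mkₐ_eq_mk, hFI] using h)
    rw [hφF]
    exact Finset.sum_eq_zero fun j _ => by rw [congrFun hzero j, Pi.zero_apply, zero_smul]
  have hφI : ∀ F ∈ I, φ F = 0 := by
    have : I ≤ RingHom.ker φ := hI ▸ Ideal.span_le.2 hφG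
    exact fun F hF => this hF
  refine ⟨Ideal.Quotient.liftₐ I φ hφI, fun f => ?_, fun j hj => ?_⟩
  · obtain ⟨F, rfl⟩ := Ideal.Quotient.mk_surjective f
    exact DFunLike.congr_fun hmk F
  · change φ (X j) = X j
    have hzero := hind (a j - Pi.single j 1) (fun k hk => by
      have hkj : k ≠ j := by rintro rfl; exact hk hj
      simp [ha j k hk, Pi.single_eq_of_ne hkj]) (by
      simp only [Pi.sub_apply, sub_smul, Finset.sum_sub_distrib, hax]
      simp [Pi.single_apply, ite_smul])
    rw [hφX, sub_eq_zero.1 hzero]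
    simp [Pi.single_apply, ite_smul]

lemma gaussVal_le_of_tropMap {w : (MvPolynomial ι K ⧸ I) → RInf}
    (hw : w ∈ An v (MvPolynomial ι K ⧸ I)) (F : MvPolynomial ι K) :
    gaussVal v (tropMap I w) F ≤ w (Ideal.Quotient.mk I F) :=
  gaussVal_le (hw.1.comp (Ideal.Quotient.mk I)) hw.2 F

variable [LinearOrder ι]

lemma gaussVal_comp_mem_An (hv : IsVal v) (η : ι → RInf)
    (ψ : (MvPolynomial ι K ⧸ I) →ₐ[K] MvPolynomial ι K) :
    (fun f => gaussVal v η (ψ f)) ∈ An v (MvPolynomial ι K ⧸ I) :=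
  ⟨(isVal_gaussVal hv η).comp ψ.toRingHom, fun c => by
    beta_reduce
    rw [AlgHom.commutes]
    exact gaussVal_C hv η c⟩

/-- The Gauss valuation induced on the coordinate ring does not depend on the section, as
long as its tropicalisation is the given weight. -/
lemma gaussVal_comp_eq (hv : IsVal v) {η : ι → RInf}
    {ψ ψ' : (MvPolynomial ι K ⧸ I) →ₐ[K] MvPolynomial ι K}
    (hψ : ∀ f, Ideal.Quotient.mk I (ψ f) = f) (hψ' : ∀ f, Ideal.Quotient.mk I (ψ' f) = f)
    (hη : tropMap I (fun f => gaussVal v η (ψ f)) = η)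
    (hη' : tropMap I (fun f => gaussVal v η (ψ' f)) = η) (f : MvPolynomial ι K ⧸ I) :
    gaussVal v η (ψ f) = gaussVal v η (ψ' f) := by
  refine le_antisymm ?_ ?_
  · simpa only [hη', hψ] using gaussVal_le_of_tropMap (gaussVal_comp_mem_An hv η ψ') (ψ f)
  · simpa only [hη, hψ'] using gaussVal_le_of_tropMap (gaussVal_comp_mem_An hv η ψ) (ψ' f)

lemma tropMap_gaussVal_comp (hv : IsVal v) {η : ι → RInf} (hη : η ∈ TropSet v I)
    {S : Finset ι} {ψ : (MvPolynomial ι K ⧸ I) →ₐ[K] MvPolynomial ι K}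
    (hψ : IsCoordSection I S ψ)
    (hS : ∀ i, Dominates v η (fun j => Ideal.Quotient.mk I (X j)) S
      (Ideal.Quotient.mk I (X i)) (η i)) :
    tropMap I (fun f => gaussVal v η (ψ f)) = η := by
  obtain ⟨w, hw, hwη⟩ := hη
  funext i
  refine le_antisymm ?_ ?_
  · have h := gaussVal_le_of_tropMap hw (ψ (Ideal.Quotient.mk I (X i)))
    rw [hψ.1, hwη] at h
    exact h.trans_eq (congrFun hwη i)
  · obtain ⟨c, hcS, hc, hcη⟩ := hS i
    change η i ≤ gaussVal v η (ψ (Ideal.Quotient.mk I (X i)))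
    rw [← hc, map_sum]
    refine (isVal_gaussVal hv η).le_map_sum fun j _ => ?_
    by_cases hj : j ∈ S
    · rw [map_smul, hψ.2 j hj, smul_eq_C_mul, gaussVal_mul hv, gaussVal_C hv]
      exact (hcη j).trans (add_le_add_right (le_gaussVal_X hv η j) _)
    · rw [hcS j hj, zero_smul, map_zero, (isVal_gaussVal hv η).map_zero]
      exact le_top

end LinearSpace

/-- For a linear subspace `Y ⊆ 𝔸ⁿ` (i.e. `I` generated by homogeneous
linear forms), the surjection `trop : Y^an → Trop(Y)` has a continuous section. -/
theorem linear_space_has_continuous_section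
    {K : Type*} [Field K] (v : K → RInf) (hv : IsVal v)
    (hsurj : Function.Surjective v) (n : ℕ)
    (I : Ideal (MvPolynomial (Fin n) K))
    (hlin : ∃ S : Set (MvPolynomial (Fin n) K),
      (∀ F ∈ S, F.IsHomogeneous 1) ∧ I = Ideal.span S) :
    ∃ σ : TropSet v I →
        {w : (MvPolynomial (Fin n) K ⧸ I) → RInf //
          w ∈ An v (MvPolynomial (Fin n) K ⧸ I)},
      Continuous σ ∧
      ∀ η : TropSet v I, tropMap I (σ η).val = (η : Fin n → RInf) := by
  obtain ⟨G, hG, hI⟩ := hlin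
  let J := {S : Finset (Fin n) // ∃ ψ, IsCoordSection I S ψ}
  choose ψ hψ using fun S : J => S.2
  let C : J → Set (TropSet v I) := fun S =>
    {η | tropMap I (fun f => gaussVal v η.1 (ψ S f)) = η.1}
  have hcont (S : J) (f) : Continuous fun η : TropSet v I => gaussVal v η.1 (ψ S f) :=
    (continuous_gaussVal v (ψ S f)).comp continuous_subtype_val
  have hclosed (S : J) : IsClosed (C S) :=
    isClosed_eq (continuous_pi fun i => hcont S _) continuous_subtype_val
  have hcover (η : TropSet v I) : ∃ S, η ∈ C S := by
    obtain ⟨S, hS, hind⟩ := exists_adapted_independent hv η.1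
      (fun i => Ideal.Quotient.mk I (MvPolynomial.X i))
    have hex : ∃ ψ, IsCoordSection I S ψ :=
      exists_isCoordSection hG hI (fun i => (hS i).imp fun c hc => ⟨hc.1, hc.2.1⟩) hind
    exact ⟨⟨S, hex⟩, tropMap_gaussVal_comp hv η.2 (hψ ⟨S, hex⟩) hS⟩
  choose s hs using hcover
  refine ⟨fun η => ⟨fun f => gaussVal v η.1 (ψ (s η) f), gaussVal_comp_mem_An hv η.1 _⟩,
    ?_, fun η => hs η⟩
  refine Continuous.subtype_mk (continuous_pi fun f => ?_) _
  refine (locallyFinite_of_finite C).continuous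
    (Set.eq_univ_of_forall fun η => Set.mem_iUnion.2 ⟨s η, hs η⟩) hclosed fun S => ?_
  refine (hcont S f).continuousOn.congr fun η hη => ?_
  exact gaussVal_comp_eq hv (hψ _).1 (hψ S).1 (hs η) hη f
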